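/- Let μ be a real rational function of k without poles in (−1,1), such that μ(k) ∈ [0,1) for all k ∈ (−1,1) and μ′(0) ≠ 0. Let m, n, l be natural numbers and let k₁, …, k_{m+n+l+2} be any m+n+l+2 distinct points in (−1,1). Then there exist real polynomials p, q, r with deg p ≤ m, deg q ≤ n, deg r ≤ l, not all identically zero, such that the function I(k) = p(k)K(k) + q(k)E(k) + r(k)Π(μ(k),k) is not identically zero on (−1,1) and satisfies I(k_i) = 0 for every i = 1, …, m+n+l+2; in particular I has at least m+n+l+2 zeros in (−1,1). -/

import Mathlib

/-- Complete elliptic integral of the first kind. -/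
noncomputable def Kc (k : ℝ) : ℝ :=
  ∫ z in (0:ℝ)..1, 1 / Real.sqrt ((1 - z ^ 2) * (1 - k ^ 2 * z ^ 2))

/-- Complete elliptic integral of the second kind. -/
noncomputable def Ec (k : ℝ) : ℝ :=
  ∫ z in (0:ℝ)..1, Real.sqrt (1 - k ^ 2 * z ^ 2) / Real.sqrt (1 - z ^ 2)

/-- Complete elliptic integral of the third kind. -/
noncomputable def Pic (μ k : ℝ) : ℝ :=
  ∫ z in (0:ℝ)..1, 1 / ((1 - μ * z ^ 2) * Real.sqrt ((1 - z ^ 2) * (1 - k ^ 2 * z ^ 2)))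


open Set Filter Topology MeasureTheory

/-- Differentiation under the integral sign for a jointly continuous derivative. -/
theorem hasDerivAt_intervalIntegral_of_continuousOn {F F' : ℝ → ℝ → ℝ} {U : Set ℝ}
    (hU : IsOpen U) (hF : ∀ x ∈ U, Continuous (F x))
    (hF' : ContinuousOn (fun y : ℝ × ℝ => F' y.1 y.2) (U ×ˢ univ))
    (hd : ∀ x ∈ U, ∀ t, HasDerivAt (fun y => F y t) (F' x t) x)
    (a b : ℝ) {x : ℝ} (hx : x ∈ U) :
    HasDerivAt (fun y => ∫ t in a..b, F y t) (∫ t in a..b, F' x t) x := by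
  obtain ⟨ε, hε, hball⟩ := Metric.nhds_basis_closedBall.mem_iff.1 (hU.mem_nhds hx)
  have hcpt : IsCompact (Metric.closedBall x ε ×ˢ uIcc a b) :=
    (isCompact_closedBall x ε).prod isCompact_uIcc
  obtain ⟨M, hM⟩ := hcpt.exists_bound_of_continuousOn
    (hF'.mono (prod_mono hball (subset_univ _)))
  have hF'x : Continuous (F' x) := by
    rw [← continuousOn_univ]
    exact hF'.comp (f := fun t : ℝ => (x, t)) (by fun_prop) (fun t _ => ⟨hx, mem_univ _⟩)
  refine (intervalIntegral.hasDerivAt_integral_of_dominated_loc_of_deriv_le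
    (bound := fun _ => M) (s := Metric.closedBall x ε)
    (Metric.closedBall_mem_nhds x hε) ?_ ((hF x hx).intervalIntegrable _ _)
    hF'x.aestronglyMeasurable ?_ intervalIntegrable_const ?_).2
  · filter_upwards [hU.mem_nhds hx] with y hy using (hF y hy).aestronglyMeasurable
  · exact .of_forall fun t ht y hy => hM (y, t) ⟨hy, uIoc_subset_uIcc ht⟩
  · exact .of_forall fun t _ y hy => hd y (hball hy) t

/-- The substitution `z = sin t` on `[0, 1]`, valid without integrability assumptions. -/
theorem integral_zero_one_eq_integral_sin (g : ℝ → ℝ) :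
    ∫ z in (0:ℝ)..1, g z = ∫ t in (0:ℝ)..(Real.pi / 2), Real.cos t * g (Real.sin t) := by
  have hpi := Real.pi_pos
  have himg : Real.sin '' Ioo 0 (Real.pi / 2) = Ioo 0 1 := by
    ext z
    constructor
    · rintro ⟨t, ⟨h0, h1⟩, rfl⟩
      refine ⟨Real.sin_pos_of_pos_of_lt_pi h0 (by linarith), ?_⟩
      rw [← Real.sin_pi_div_two]
      exact Real.sin_lt_sin_of_lt_of_le_pi_div_two (by linarith) le_rfl h1
    · rintro ⟨h0, h1⟩
      exact ⟨Real.arcsin z, ⟨Real.arcsin_pos.2 h0, Real.arcsin_lt_pi_div_two.2 h1⟩,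
        Real.sin_arcsin (by linarith) h1.le⟩
  rw [intervalIntegral.integral_of_le zero_le_one, integral_Ioc_eq_integral_Ioo, ← himg,
    integral_image_eq_integral_abs_deriv_smul measurableSet_Ioo
      (fun t _ => (Real.hasDerivAt_sin t).hasDerivWithinAt)
      (Real.injOn_sin.mono (Ioo_subset_Icc_self.trans (Icc_subset_Icc (by linarith) le_rfl))),
    intervalIntegral.integral_of_le (by positivity), integral_Ioc_eq_integral_Ioo]
  refine setIntegral_congr_fun measurableSet_Ioo fun t ht => ?_
  have : 0 < Real.cos t := Real.cos_pos_of_mem_Ioo ⟨by linarith [ht.1], ht.2⟩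
  simp only [abs_of_pos this, smul_eq_mul]

/-- The radical `√(1 - k² sin² t)` of Legendre's normal form. -/
noncomputable def legendreDelta (k t : ℝ) : ℝ := Real.sqrt (1 - k ^ 2 * Real.sin t ^ 2)

theorem integral_sin_congr {g h : ℝ → ℝ}
    (H : ∀ t, 0 < Real.cos t → Real.cos t * g (Real.sin t) = h t) :
    ∫ z in (0:ℝ)..1, g z = ∫ t in (0:ℝ)..(Real.pi / 2), h t := by
  have hpi := Real.pi_pos
  rw [integral_zero_one_eq_integral_sin, intervalIntegral.integral_of_le (by positivity),
    intervalIntegral.integral_of_le (by positivity), integral_Ioc_eq_integral_Ioo,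
    integral_Ioc_eq_integral_Ioo]
  exact setIntegral_congr_fun measurableSet_Ioo fun t ht =>
    H t (Real.cos_pos_of_mem_Ioo ⟨by linarith [ht.1], ht.2⟩)

theorem Pic_eq_integral (μ k : ℝ) :
    Pic μ k = ∫ t in (0:ℝ)..(Real.pi / 2),
      1 / ((1 - μ * Real.sin t ^ 2) * legendreDelta k t) := by
  refine integral_sin_congr fun t ht => ?_
  rw [← Real.cos_sq', Real.sqrt_mul (sq_nonneg _), Real.sqrt_sq ht.le]
  change _ * (1 / (_ * (_ * legendreDelta k t))) = _
  rw [mul_one_div, mul_left_comm, ← div_div, div_self ht.ne']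

theorem Ec_eq_integral (k : ℝ) :
    Ec k = ∫ t in (0:ℝ)..(Real.pi / 2), legendreDelta k t := by
  refine integral_sin_congr fun t ht => ?_
  rw [← Real.cos_sq', Real.sqrt_sq ht.le, mul_div_cancel₀ _ ht.ne']
  rfl

theorem Kc_eq_Pic (k : ℝ) : Kc k = Pic 0 k := by
  simp [Kc, Pic]

theorem Kc_eq_integral (k : ℝ) :
    Kc k = ∫ t in (0:ℝ)..(Real.pi / 2), 1 / legendreDelta k t := by
  simp [Kc_eq_Pic, Pic_eq_integral]

theorem one_sub_mul_sin_sq_pos {a : ℝ} (ha : a < 1) (t : ℝ) : 0 < 1 - a * Real.sin t ^ 2 := by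
  have h1 := Real.sin_sq_le_one t
  have h0 := sq_nonneg (Real.sin t)
  rcases le_or_gt a 0 with h | h <;> nlinarith

theorem sq_lt_one_of_mem {k : ℝ} (hk : k ∈ Ioo (-1 : ℝ) 1) : k ^ 2 < 1 := by
  nlinarith [hk.1, hk.2]

theorem legendreDelta_pos {k : ℝ} (hk : k ∈ Ioo (-1 : ℝ) 1) (t : ℝ) :
    0 < legendreDelta k t :=
  Real.sqrt_pos.2 (one_sub_mul_sin_sq_pos (sq_lt_one_of_mem hk) t)

theorem legendreDelta_sq {k : ℝ} (hk : k ∈ Ioo (-1 : ℝ) 1) (t : ℝ) :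
    legendreDelta k t ^ 2 = 1 - k ^ 2 * Real.sin t ^ 2 :=
  Real.sq_sqrt (one_sub_mul_sin_sq_pos (sq_lt_one_of_mem hk) t).le

theorem continuous_legendreDelta : Continuous fun y : ℝ × ℝ => legendreDelta y.1 y.2 := by
  unfold legendreDelta
  fun_prop

theorem hasDerivAt_legendreDelta_left {k : ℝ} (hk : k ∈ Ioo (-1 : ℝ) 1) (t : ℝ) :
    HasDerivAt (fun x => legendreDelta x t)
      (-(k * Real.sin t ^ 2) / legendreDelta k t) k := by
  have h : HasDerivAt (fun x : ℝ => 1 - x ^ 2 * Real.sin t ^ 2)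
      (-(2 * k * Real.sin t ^ 2)) k := by
    simpa using ((hasDerivAt_pow 2 k).mul_const (Real.sin t ^ 2)).const_sub 1
  refine (h.sqrt (one_sub_mul_sin_sq_pos (sq_lt_one_of_mem hk) t).ne').congr_deriv ?_
  have := (legendreDelta_pos hk t).ne'
  change _ / (2 * legendreDelta k t) = _
  field_simp

theorem hasDerivAt_legendreDelta_right {k : ℝ} (hk : k ∈ Ioo (-1 : ℝ) 1) (t : ℝ) :
    HasDerivAt (fun x => legendreDelta k x)
      (-(k ^ 2 * Real.sin t * Real.cos t) / legendreDelta k t) t := by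
  have h : HasDerivAt (fun x : ℝ => 1 - k ^ 2 * Real.sin x ^ 2)
      (-(k ^ 2 * (2 * Real.sin t * Real.cos t))) t := by
    simpa using (((Real.hasDerivAt_sin t).pow 2).const_mul (k ^ 2)).const_sub 1
  refine (h.sqrt (one_sub_mul_sin_sq_pos (sq_lt_one_of_mem hk) t).ne').congr_deriv ?_
  have := (legendreDelta_pos hk t).ne'
  change _ / (2 * legendreDelta k t) = _
  field_simp

theorem continuous_legendreDelta_right (k : ℝ) : Continuous (legendreDelta k) :=
  continuous_legendreDelta.comp (by fun_prop : Continuous fun t : ℝ => (k, t))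

theorem continuous_one_div_legendreDelta {k : ℝ} (hk : k ∈ Ioo (-1 : ℝ) 1) :
    Continuous fun t => 1 / legendreDelta k t :=
  continuous_const.div (continuous_legendreDelta_right k) fun t => (legendreDelta_pos hk t).ne'

theorem hasDerivAt_Ec {k : ℝ} (hk : k ∈ Ioo (-1 : ℝ) 1) :
    ∃ d, HasDerivAt Ec d k ∧ k * d = Ec k - Kc k := by
  refine ⟨∫ t in (0:ℝ)..(Real.pi / 2), -(k * Real.sin t ^ 2) / legendreDelta k t, ?_, ?_⟩
  · rw [funext Ec_eq_integral]
    refine hasDerivAt_intervalIntegral_of_continuousOn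
      (F' := fun k t => -(k * Real.sin t ^ 2) / legendreDelta k t) isOpen_Ioo
      (fun x _ => continuous_legendreDelta_right x) ?_
      (fun x hx t => hasDerivAt_legendreDelta_left hx t) _ _ hk
    exact ContinuousOn.div (by fun_prop) continuous_legendreDelta.continuousOn
      fun y hy => (legendreDelta_pos hy.1 _).ne'
  · rw [Ec_eq_integral, Kc_eq_integral, ← intervalIntegral.integral_const_mul,
      ← intervalIntegral.integral_sub
        ((continuous_legendreDelta_right k).intervalIntegrable _ _)
        ((continuous_one_div_legendreDelta hk).intervalIntegrable _ _)]
    refine intervalIntegral.integral_congr fun t _ => ?_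
    have h0 := (legendreDelta_pos hk t).ne'
    have h1 := legendreDelta_sq hk t
    field_simp
    linear_combination -h1

/-- Derivative of the third-kind integrand along a curve `μ` of parameters. -/
theorem hasDerivAt_Pic_integrand {μ : ℝ → ℝ} {μ' k : ℝ} (hk : k ∈ Ioo (-1 : ℝ) 1)
    (hμ1 : μ k < 1) (hμ : HasDerivAt μ μ' k) (t : ℝ) :
    HasDerivAt (fun x => 1 / ((1 - μ x * Real.sin t ^ 2) * legendreDelta x t))
      (μ' * Real.sin t ^ 2 / ((1 - μ k * Real.sin t ^ 2) ^ 2 * legendreDelta k t)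
        + k * Real.sin t ^ 2 / ((1 - μ k * Real.sin t ^ 2) * legendreDelta k t ^ 3)) k := by
  have h0 := (legendreDelta_pos hk t).ne'
  have h1 := (one_sub_mul_sin_sq_pos hμ1 t).ne'
  have h := ((((hμ.mul_const (Real.sin t ^ 2)).const_sub 1).mul
    (hasDerivAt_legendreDelta_left hk t)).inv (mul_ne_zero h1 h0))
  simp only [one_div]
  refine h.congr_deriv ?_
  simp only [Pi.mul_apply]
  field_simp
  ring

theorem hasDerivAt_Pic {μ μ' : ℝ → ℝ} (hμ1 : ∀ x ∈ Ioo (-1 : ℝ) 1, μ x < 1)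
    (hμ : ∀ x ∈ Ioo (-1 : ℝ) 1, HasDerivAt μ (μ' x) x)
    (hμ' : ContinuousOn μ' (Ioo (-1 : ℝ) 1)) {k : ℝ} (hk : k ∈ Ioo (-1 : ℝ) 1) :
    HasDerivAt (fun x => Pic (μ x) x) (∫ t in (0:ℝ)..(Real.pi / 2),
      (μ' k * Real.sin t ^ 2 / ((1 - μ k * Real.sin t ^ 2) ^ 2 * legendreDelta k t)
        + k * Real.sin t ^ 2 / ((1 - μ k * Real.sin t ^ 2) * legendreDelta k t ^ 3))) k := by
  have hμc : ContinuousOn μ (Ioo (-1 : ℝ) 1) := fun x hx =>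
    (hμ x hx).continuousAt.continuousWithinAt
  have hfst : MapsTo (Prod.fst : ℝ × ℝ → ℝ) (Ioo (-1 : ℝ) 1 ×ˢ univ) (Ioo (-1 : ℝ) 1) :=
    fun y hy => hy.1
  have h1 : ContinuousOn (fun y : ℝ × ℝ => μ y.1) (Ioo (-1 : ℝ) 1 ×ˢ univ) :=
    hμc.comp continuousOn_fst hfst
  have h2 : ContinuousOn (fun y : ℝ × ℝ => μ' y.1) (Ioo (-1 : ℝ) 1 ×ˢ univ) :=
    hμ'.comp continuousOn_fst hfst
  have h3 := continuous_legendreDelta.continuousOn (s := Ioo (-1 : ℝ) 1 ×ˢ univ)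
  rw [funext fun x => Pic_eq_integral (μ x) x]
  refine hasDerivAt_intervalIntegral_of_continuousOn
    (F' := fun k t => (μ' k * Real.sin t ^ 2 /
        ((1 - μ k * Real.sin t ^ 2) ^ 2 * legendreDelta k t)
      + k * Real.sin t ^ 2 / ((1 - μ k * Real.sin t ^ 2) * legendreDelta k t ^ 3))) isOpen_Ioo
    (fun x hx => ?_) ?_ (fun x hx t => hasDerivAt_Pic_integrand hx (hμ1 x hx) (hμ x hx) t) _ _ hk
  · have := continuous_legendreDelta_right x
    exact continuous_const.div (by fun_prop) fun t =>
      mul_ne_zero (one_sub_mul_sin_sq_pos (hμ1 x hx) t).ne' (legendreDelta_pos hx t).ne'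
  · refine ContinuousOn.add (ContinuousOn.div (by fun_prop) (by fun_prop) fun y hy => ?_)
      (ContinuousOn.div (by fun_prop) (by fun_prop) fun y hy => ?_)
    all_goals
      have := (one_sub_mul_sin_sq_pos (hμ1 _ hy.1) y.2).ne'
      have := (legendreDelta_pos hy.1 y.2).ne'
      positivity

theorem hasDerivAt_sin_mul_cos (t : ℝ) :
    HasDerivAt (fun x => Real.sin x * Real.cos x) (Real.cos t ^ 2 - Real.sin t ^ 2) t := by
  refine ((Real.hasDerivAt_sin t).mul (Real.hasDerivAt_cos t)).congr_deriv ?_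
  ring

/-- Integrating the derivative of a function vanishing at both ends. -/
theorem integral_eq_zero_of_hasDerivAt_sin_mul_cos {g : ℝ → ℝ} {f : ℝ → ℝ} (hf : Continuous f)
    (h : ∀ t, HasDerivAt (fun x => Real.sin x * Real.cos x * g x) (f t) t) :
    ∫ t in (0:ℝ)..(Real.pi / 2), f t = 0 := by
  rw [intervalIntegral.integral_eq_sub_of_hasDerivAt (fun t _ => h t) (hf.intervalIntegrable _ _)]
  simp

theorem hasDerivAt_Kc {k : ℝ} (hk : k ∈ Ioo (-1 : ℝ) 1) :
    ∃ d, HasDerivAt Kc d k ∧ k * (1 - k ^ 2) * d = Ec k - (1 - k ^ 2) * Kc k := by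
  have hD := hasDerivAt_Pic (μ := fun _ => 0) (μ' := fun _ => 0) (by simp)
    (fun x _ => hasDerivAt_const x 0) continuousOn_const hk
  simp only [← Kc_eq_Pic] at hD
  simp only [zero_mul, zero_div, sub_zero, one_mul, zero_add] at hD
  refine ⟨_, hD, ?_⟩
  have hc := continuous_legendreDelta_right k
  have hne := fun t => (legendreDelta_pos hk t).ne'
  have hc1 := continuous_one_div_legendreDelta hk
  have hc3 : Continuous fun t => k * Real.sin t ^ 2 / legendreDelta k t ^ 3 :=
    Continuous.div (by fun_prop) (by fun_prop) fun t => pow_ne_zero _ (hne t)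
  have key := integral_eq_zero_of_hasDerivAt_sin_mul_cos
    (g := fun t => k ^ 2 / legendreDelta k t)
    (f := fun t => legendreDelta k t - (1 - k ^ 2) * (1 / legendreDelta k t)
      - k * (1 - k ^ 2) * (k * Real.sin t ^ 2 / legendreDelta k t ^ 3)) (by fun_prop) fun t => by
    have h := (hasDerivAt_sin_mul_cos t).mul
      ((hasDerivAt_const t (k ^ 2)).div (hasDerivAt_legendreDelta_right hk t) (hne t))
    refine h.congr_deriv ?_
    have h0 := hne t
    have h1 := legendreDelta_sq hk t
    have h2 := Real.sin_sq_add_cos_sq t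
    simp only [Pi.div_apply]
    field_simp
    have e4 : legendreDelta k t ^ 4 = (legendreDelta k t ^ 2) ^ 2 := by ring
    have h3 : Real.cos t ^ 2 = 1 - Real.sin t ^ 2 := by linarith
    ring_nf
    simp only [e4, h1, h3]
    ring
  rw [intervalIntegral.integral_sub, intervalIntegral.integral_sub,
    intervalIntegral.integral_const_mul, intervalIntegral.integral_const_mul,
    ← Ec_eq_integral, ← Kc_eq_integral] at key
  · linarith
  all_goals exact Continuous.intervalIntegrable (by fun_prop) _ _

theorem Pic_ode {μ μ' : ℝ → ℝ} (hμ1 : ∀ x ∈ Ioo (-1 : ℝ) 1, μ x < 1)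
    (hμ : ∀ x ∈ Ioo (-1 : ℝ) 1, HasDerivAt μ (μ' x) x)
    (hμ' : ContinuousOn μ' (Ioo (-1 : ℝ) 1)) {k : ℝ} (hk : k ∈ Ioo (-1 : ℝ) 1) :
    ∃ d, HasDerivAt (fun x => Pic (μ x) x) d k ∧
      2 * μ k * (1 - μ k) * (μ k - k ^ 2) * (1 - k ^ 2) * d =
        μ' k * (1 - k ^ 2) * (μ k * Ec k + (k ^ 2 - μ k) * Kc k
          + (μ k ^ 2 - k ^ 2) * Pic (μ k) k)
        + 2 * μ k * (1 - μ k) * k * ((1 - k ^ 2) * Pic (μ k) k - Ec k) := by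
  refine ⟨_, hasDerivAt_Pic hμ1 hμ hμ' hk, ?_⟩
  have hn := hμ1 k hk
  generalize μ k = n at hn ⊢
  generalize μ' k = m
  have hc := continuous_legendreDelta_right k
  have hne := fun t => (legendreDelta_pos hk t).ne'
  have hnu := fun t => (one_sub_mul_sin_sq_pos hn t).ne'
  have hc1 := continuous_one_div_legendreDelta hk
  have hc2 : Continuous fun t => 1 / ((1 - n * Real.sin t ^ 2) * legendreDelta k t) :=
    Continuous.div (by fun_prop) (by fun_prop) fun t => mul_ne_zero (hnu t) (hne t)
  have hc3 : Continuous fun t =>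
      m * Real.sin t ^ 2 / ((1 - n * Real.sin t ^ 2) ^ 2 * legendreDelta k t)
        + k * Real.sin t ^ 2 / ((1 - n * Real.sin t ^ 2) * legendreDelta k t ^ 3) :=
    Continuous.add
      (Continuous.div (by fun_prop) (by fun_prop) fun t =>
        mul_ne_zero (pow_ne_zero _ (hnu t)) (hne t))
      (Continuous.div (by fun_prop) (by fun_prop) fun t =>
        mul_ne_zero (hnu t) (pow_ne_zero _ (hne t)))
  have key := integral_eq_zero_of_hasDerivAt_sin_mul_cos
    (g := fun t => 2 * n * (1 - n) * k ^ 3 / legendreDelta k t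
      - n ^ 2 * m * (1 - k ^ 2) * legendreDelta k t / (1 - n * Real.sin t ^ 2))
    (f := fun t => 2 * n * (1 - n) * (n - k ^ 2) * (1 - k ^ 2) *
        (m * Real.sin t ^ 2 / ((1 - n * Real.sin t ^ 2) ^ 2 * legendreDelta k t)
        + k * Real.sin t ^ 2 / ((1 - n * Real.sin t ^ 2) * legendreDelta k t ^ 3))
      - (m * (1 - k ^ 2) * n - 2 * n * (1 - n) * k) * legendreDelta k t
      - m * (1 - k ^ 2) * (k ^ 2 - n) * (1 / legendreDelta k t)
      - (m * (1 - k ^ 2) * (n ^ 2 - k ^ 2) + 2 * n * (1 - n) * k * (1 - k ^ 2))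
        * (1 / ((1 - n * Real.sin t ^ 2) * legendreDelta k t))) (by fun_prop) fun t => by
    have hden : HasDerivAt (fun x : ℝ => 1 - n * Real.sin x ^ 2)
        (-(n * (2 * Real.sin t * Real.cos t))) t := by
      simpa using (((Real.hasDerivAt_sin t).pow 2).const_mul n).const_sub 1
    have hΔ := hasDerivAt_legendreDelta_right hk t
    have h := (hasDerivAt_sin_mul_cos t).mul
      (((hasDerivAt_const t (2 * n * (1 - n) * k ^ 3)).div hΔ (hne t)).sub
        ((hΔ.const_mul (n ^ 2 * m * (1 - k ^ 2))).div hden (hnu t)))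
    refine h.congr_deriv ?_
    have h0 := hne t
    have h0' := hnu t
    have h1 := legendreDelta_sq hk t
    have h3 : Real.cos t ^ 2 = 1 - Real.sin t ^ 2 := by linarith [Real.sin_sq_add_cos_sq t]
    have e4 : legendreDelta k t ^ 4 = (legendreDelta k t ^ 2) ^ 2 := by ring
    simp only [Pi.div_apply, Pi.sub_apply]
    generalize hν : 1 - n * Real.sin t ^ 2 = ν at h0' ⊢
    field_simp
    subst hν
    ring_nf
    simp only [e4, h1, h3]
    ring
  rw [intervalIntegral.integral_sub, intervalIntegral.integral_sub, intervalIntegral.integral_sub,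
    intervalIntegral.integral_const_mul, intervalIntegral.integral_const_mul,
    intervalIntegral.integral_const_mul, intervalIntegral.integral_const_mul,
    ← Ec_eq_integral, ← Kc_eq_integral, ← Pic_eq_integral] at key
  · linarith
  all_goals exact Continuous.intervalIntegrable (by fun_prop) _ _

theorem one_le_Ec (k : ℝ) (hk : k ∈ Ioo (-1 : ℝ) 1) : 1 ≤ Ec k := by
  have hpi := Real.pi_pos
  have hcos : ∫ t in (0:ℝ)..(Real.pi / 2), Real.cos t = 1 := by simp
  rw [Ec_eq_integral, ← hcos]
  refine intervalIntegral.integral_mono_on (by positivity)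
    (Real.continuous_cos.intervalIntegrable _ _)
    ((continuous_legendreDelta_right k).intervalIntegrable _ _) fun t _ => ?_
  refine (le_abs_self _).trans (Real.abs_le_sqrt ?_)
  have := sq_lt_one_of_mem hk
  nlinarith [Real.sin_sq_add_cos_sq t, sq_nonneg (Real.sin t)]

theorem Kc_nonneg (k : ℝ) : 0 ≤ Kc k := by
  rw [Kc_eq_integral]
  exact intervalIntegral.integral_nonneg (by positivity) fun t _ =>
    one_div_nonneg.2 (Real.sqrt_nonneg _)

theorem Kc_le {k : ℝ} (hk : k ∈ Ioo (-1 : ℝ) 1) :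
    Kc k ≤ Real.pi / 2 * (1 / Real.sqrt (1 - k ^ 2)) := by
  have hpi := Real.pi_pos
  have hk2 := sq_lt_one_of_mem hk
  have hconst : ∫ _ in (0:ℝ)..(Real.pi / 2), 1 / Real.sqrt (1 - k ^ 2)
      = Real.pi / 2 * (1 / Real.sqrt (1 - k ^ 2)) := by simp
  rw [Kc_eq_integral, ← hconst]
  refine intervalIntegral.integral_mono_on (by positivity)
    ((continuous_one_div_legendreDelta hk).intervalIntegrable _ _)
    intervalIntegrable_const fun t _ => ?_
  refine one_div_le_one_div_of_le (Real.sqrt_pos.2 (by linarith)) (Real.sqrt_le_sqrt ?_)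
  nlinarith [Real.sin_sq_le_one t, sq_nonneg k]

/-- `K / E` grows more slowly than `1 / (1 - k)` at `k = 1`. -/
theorem tendsto_one_sub_mul_Kc_div_Ec :
    Tendsto (fun k => (1 - k) * (Kc k / Ec k)) (𝓝[<] 1) (𝓝 0) := by
  have hev : ∀ᶠ k in 𝓝[<] (1 : ℝ), k ∈ Ioo (0 : ℝ) 1 := Ioo_mem_nhdsLT zero_lt_one
  have hlim : Tendsto (fun k : ℝ => Real.pi / 2 * Real.sqrt (1 - k ^ 2)) (𝓝[<] 1) (𝓝 0) := by
    have : ContinuousAt (fun k : ℝ => Real.pi / 2 * Real.sqrt (1 - k ^ 2)) 1 := by fun_prop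
    simpa using this.tendsto.mono_left nhdsWithin_le_nhds
  refine tendsto_of_tendsto_of_tendsto_of_le_of_le' tendsto_const_nhds hlim ?_ ?_
  · filter_upwards [hev] with k hk
    have hE := one_le_Ec k ⟨by linarith [hk.1], hk.2⟩
    exact mul_nonneg (by linarith [hk.2]) (div_nonneg (Kc_nonneg k) (by linarith))
  · filter_upwards [hev] with k hk
    have hk' : k ∈ Ioo (-1 : ℝ) 1 := ⟨by linarith [hk.1], hk.2⟩
    have hE := one_le_Ec k hk'
    have hk2 := sq_lt_one_of_mem hk'
    have hs : 0 < Real.sqrt (1 - k ^ 2) := Real.sqrt_pos.2 (by linarith)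
    calc (1 - k) * (Kc k / Ec k) ≤ (1 - k ^ 2) * Kc k := by
          refine mul_le_mul (by nlinarith [hk.1, hk.2]) (div_le_self (Kc_nonneg k) hE)
            (div_nonneg (Kc_nonneg k) (by linarith)) (by linarith)
      _ ≤ (1 - k ^ 2) * (Real.pi / 2 * (1 / Real.sqrt (1 - k ^ 2))) :=
          mul_le_mul_of_nonneg_left (Kc_le hk') (by linarith)
      _ = Real.pi / 2 * Real.sqrt (1 - k ^ 2) := by
          have hsq := Real.sq_sqrt (show 0 ≤ 1 - k ^ 2 by linarith)
          field_simp
          exact hsq.symm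

open Polynomial in
theorem eq_zero_of_eval_eq_zero_on_Ioo {p : ℝ[X]}
    (h : ∀ k ∈ Ioo (-1 : ℝ) 1, p.eval k = 0) : p = 0 :=
  p.eq_zero_of_infinite_isRoot ((Ioo_infinite (by norm_num)).mono h)

open Polynomial in
theorem eval_one_eq_zero_of_tendsto {p : ℝ[X]}
    (h : Tendsto (fun k => p.eval k) (𝓝[<] 1) (𝓝 0)) : p.IsRoot 1 :=
  tendsto_nhds_unique (p.continuous.continuousAt.tendsto.mono_left nhdsWithin_le_nhds) h

open Polynomial in
theorem eval_one_eq_zero_of_Kc_Ec {p q : ℝ[X]}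
    (h : ∀ k ∈ Ioo (-1 : ℝ) 1, p.eval k * Kc k + q.eval k * Ec k = 0) :
    p.IsRoot 1 ∧ q.IsRoot 1 := by
  have hev : ∀ᶠ k in 𝓝[<] (1 : ℝ), k ∈ Ioo (-1 : ℝ) 1 := Ioo_mem_nhdsLT (by norm_num)
  have hlim := tendsto_one_sub_mul_Kc_div_Ec
  have hpoly : ∀ f : ℝ[X], Tendsto (fun k => f.eval k) (𝓝[<] 1) (𝓝 (f.eval 1)) := fun f =>
    f.continuous.continuousAt.tendsto.mono_left nhdsWithin_le_nhds
  have hp : p.IsRoot 1 := by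
    have hl := (hlim.mul (hpoly (-((1 + X) * (X * derivative p - p - q))))).add
      (hpoly (-((1 - X ^ 2) * (X * derivative q + q))))
    refine eval_one_eq_zero_of_tendsto ((hl.congr' ?_).trans_eq ?_)
    · filter_upwards [hev] with k hk
      obtain ⟨dK, hdK, eK⟩ := hasDerivAt_Kc hk
      obtain ⟨dE, hdE, eE⟩ := hasDerivAt_Ec hk
      have hE : Ec k ≠ 0 := by linarith [one_le_Ec k hk]
      have e1 : (derivative p).eval k * Kc k + p.eval k * dK
          + ((derivative q).eval k * Ec k + q.eval k * dE) = 0 := by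
        refine (((p.hasDerivAt k).mul hdK).add ((q.hasDerivAt k).mul hdE)).unique ?_
        refine (hasDerivAt_const k (0 : ℝ)).congr_of_eventuallyEq ?_
        filter_upwards [isOpen_Ioo.mem_nhds hk] with x hx using h x hx
      simp only [eval_neg, eval_mul, eval_add, eval_sub, eval_X, eval_one, eval_pow]
      field_simp
      linear_combination -k * (1 - k ^ 2) * e1 + p.eval k * eK + (1 - k ^ 2) * q.eval k * eE
    · simp
  refine ⟨hp, ?_⟩
  obtain ⟨p₁, rfl⟩ := dvd_iff_isRoot.2 hp
  have hl := hlim.mul (hpoly p₁)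
  refine eval_one_eq_zero_of_tendsto ((hl.congr' ?_).trans_eq (by simp))
  filter_upwards [hev] with k hk
  have hE : Ec k ≠ 0 := by linarith [one_le_Ec k hk]
  have := h k hk
  simp only [eval_mul, eval_sub, eval_X, eval_C] at this
  field_simp
  linear_combination -this

open Polynomial in
/-- `K` and `E` are linearly independent over the polynomials. -/
theorem Kc_Ec_independent {p q : ℝ[X]}
    (h : ∀ k ∈ Ioo (-1 : ℝ) 1, p.eval k * Kc k + q.eval k * Ec k = 0) : p = 0 ∧ q = 0 := by
  induction hN : p.natDegree using Nat.strong_induction_on generalizing p q with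
  | _ N ih =>
  by_cases hp0 : p = 0
  · refine ⟨hp0, eq_zero_of_eval_eq_zero_on_Ioo fun k hk => ?_⟩
    have hE : Ec k ≠ 0 := by linarith [one_le_Ec k hk]
    simpa [hp0, hE] using h k hk
  · obtain ⟨hp, hq⟩ := eval_one_eq_zero_of_Kc_Ec h
    obtain ⟨p₁, rfl⟩ := dvd_iff_isRoot.2 hp
    obtain ⟨q₁, rfl⟩ := dvd_iff_isRoot.2 hq
    have hdeg : p₁.natDegree < N := by
      rw [← hN, natDegree_mul (X_sub_C_ne_zero 1) (right_ne_zero_of_mul hp0), natDegree_X_sub_C]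
      omega
    obtain ⟨h1, h2⟩ := ih _ hdeg (p := p₁) (q := q₁) (fun k hk => by
      have := h k hk
      simp only [eval_mul, eval_sub, eval_X, eval_C] at this
      refine (mul_eq_zero.1 (?_ : (k - 1) * _ = 0)).resolve_left (by linarith [hk.2])
      linear_combination this) rfl
    simp [h1, h2]

theorem Kc_zero_eq_Ec_zero : Kc 0 = Ec 0 := by
  obtain ⟨d, _, h⟩ := hasDerivAt_Ec (k := 0) (by norm_num)
  linarith

open Polynomial in
theorem X_mul_derivative_X_pow_mul (j : ℕ) (s : ℝ[X]) :
    X * derivative (X ^ j * s) = X ^ j * ((j : ℝ[X]) * s + X * derivative s) := by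
  cases j with
  | zero => simp
  | succ j =>
    simp only [derivative_mul, derivative_X_pow, Nat.add_sub_cancel, map_natCast]
    ring

open Polynomial in
/-- The polynomial identities obtained by differentiating a relation `p K + q E + r P = 0` and
eliminating `P`. -/
theorem coefficient_identities {P : ℝ → ℝ} {D H CK CE : ℝ[X]}
    (hP : ∀ k ∈ Ioo (-1 : ℝ) 1, ∃ d, HasDerivAt P d k ∧
      D.eval k * d = H.eval k * P k + CK.eval k * Kc k + CE.eval k * Ec k)
    {p q r : ℝ[X]}
    (h : ∀ k ∈ Ioo (-1 : ℝ) 1, p.eval k * Kc k + q.eval k * Ec k + r.eval k * P k = 0) :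
    X * (1 - X ^ 2) * D * (r * derivative p - derivative r * p)
        - (1 - X ^ 2) * D * r * (p + q) - X * (1 - X ^ 2) * (r * H * p - r ^ 2 * CK) = 0 ∧
      X * (1 - X ^ 2) * D * (r * derivative q - derivative r * q)
        + D * r * (p + (1 - X ^ 2) * q) - X * (1 - X ^ 2) * (r * H * q - r ^ 2 * CE) = 0 := by
  refine Kc_Ec_independent fun k hk => ?_
  obtain ⟨dK, hdK, eK⟩ := hasDerivAt_Kc hk
  obtain ⟨dE, hdE, eE⟩ := hasDerivAt_Ec hk
  obtain ⟨dP, hdP, eP⟩ := hP k hk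
  have e1 : (derivative p).eval k * Kc k + p.eval k * dK
      + ((derivative q).eval k * Ec k + q.eval k * dE)
      + ((derivative r).eval k * P k + r.eval k * dP) = 0 := by
    refine ((((p.hasDerivAt k).mul hdK).add ((q.hasDerivAt k).mul hdE)).add
      ((r.hasDerivAt k).mul hdP)).unique ?_
    refine (hasDerivAt_const k (0 : ℝ)).congr_of_eventuallyEq ?_
    filter_upwards [isOpen_Ioo.mem_nhds hk] with x hx using h x hx
  have e0 := h k hk
  simp only [eval_mul, eval_add, eval_sub, eval_X, eval_one, eval_pow]
  linear_combination k * (1 - k ^ 2) * D.eval k * r.eval k * e1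
    - k * (1 - k ^ 2) * D.eval k * (derivative r).eval k * e0
    - r.eval k ^ 2 * k * (1 - k ^ 2) * eP - D.eval k * r.eval k * p.eval k * eK
    - (1 - k ^ 2) * D.eval k * r.eval k * q.eval k * eE
    - r.eval k * k * (1 - k ^ 2) * H.eval k * e0

open Polynomial in
/-- A function satisfying an inhomogeneous first-order equation with polynomial coefficients
driven by `K` and `E`, regular and nonzero at `0`, is independent of `K` and `E`. -/
theorem independent_of_ode {P : ℝ → ℝ} {D H CK CE : ℝ[X]}
    (hP : ∀ k ∈ Ioo (-1 : ℝ) 1, ∃ d, HasDerivAt P d k ∧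
      D.eval k * d = H.eval k * P k + CK.eval k * Kc k + CE.eval k * Ec k)
    (hD : D.eval 0 ≠ 0) (hP0 : P 0 ≠ 0) {p q r : ℝ[X]}
    (h : ∀ k ∈ Ioo (-1 : ℝ) 1, p.eval k * Kc k + q.eval k * Ec k + r.eval k * P k = 0) :
    r = 0 := by
  have h0mem : (0 : ℝ) ∈ Ioo (-1 : ℝ) 1 := by norm_num
  induction hN : r.natDegree using Nat.strong_induction_on generalizing p q r with
  | _ N ih =>
  by_contra hr
  obtain ⟨hPK, hPE⟩ := coefficient_identities hP h
  obtain ⟨s, hrs, hs⟩ := r.exists_eq_pow_rootMultiplicity_mul_and_not_dvd hr 0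
  generalize r.rootMultiplicity 0 = j at hrs
  rw [dvd_iff_isRoot] at hs
  have hs0 : s.eval 0 ≠ 0 := hs
  rw [C_0, sub_zero] at hrs
  have hX : X * derivative r = X ^ j * ((j : ℝ[X]) * s + X * derivative s) := by
    rw [hrs, X_mul_derivative_X_pow_mul]
  have hj0 : (X : ℝ[X]) ^ j ≠ 0 := pow_ne_zero _ X_ne_zero
  have hQK : X * (1 - X ^ 2) * D * s * derivative p
      - (1 - X ^ 2) * D * ((j : ℝ[X]) * s + X * derivative s) * p
      - (1 - X ^ 2) * D * s * (p + q) - X * (1 - X ^ 2) * (s * H * p - s * r * CK) = 0 := by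
    refine mul_left_cancel₀ hj0 ?_
    rw [mul_zero, ← hPK]
    linear_combination (1 - X ^ 2) * D * p * hX
      + (-(X * (1 - X ^ 2) * D * derivative p) + (1 - X ^ 2) * D * (p + q)
        + X * (1 - X ^ 2) * (H * p - r * CK)) * hrs
  have hQE : X * (1 - X ^ 2) * D * s * derivative q
      - (1 - X ^ 2) * D * ((j : ℝ[X]) * s + X * derivative s) * q
      + D * s * (p + (1 - X ^ 2) * q) - X * (1 - X ^ 2) * (s * H * q - s * r * CE) = 0 := by
    refine mul_left_cancel₀ hj0 ?_
    rw [mul_zero, ← hPE]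
    linear_combination (1 - X ^ 2) * D * q * hX
      + (-(X * (1 - X ^ 2) * D * derivative q) - D * (p + (1 - X ^ 2) * q)
        + X * (1 - X ^ 2) * (H * q - r * CE)) * hrs
  have hDs := mul_ne_zero hD hs0
  have evK : (j : ℝ) * p.eval 0 + (p.eval 0 + q.eval 0) = 0 := by
    have := congrArg (eval 0) hQK
    simp only [eval_mul, eval_add, eval_sub, eval_X, eval_one, eval_pow, eval_natCast,
      eval_zero] at this
    refine (mul_eq_zero.1 (?_ : (D.eval 0 * s.eval 0) * _ = 0)).resolve_left hDs
    linear_combination -this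
  have evE : -((j : ℝ) * q.eval 0) + (p.eval 0 + q.eval 0) = 0 := by
    have := congrArg (eval 0) hQE
    simp only [eval_mul, eval_add, eval_sub, eval_X, eval_one, eval_pow, eval_natCast,
      eval_zero] at this
    refine (mul_eq_zero.1 (?_ : (D.eval 0 * s.eval 0) * _ = 0)).resolve_left hDs
    linear_combination this
  rcases Nat.eq_zero_or_pos j with rfl | hj
  · have e := h 0 h0mem
    have hrs' : r.eval 0 = s.eval 0 := by rw [hrs]; simp
    rw [Kc_zero_eq_Ec_zero, hrs'] at e
    refine mul_ne_zero hs0 hP0 ?_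
    push_cast at evK
    linear_combination e - Ec 0 * evK
  · have hjR : (j : ℝ) ≠ 0 := by exact_mod_cast hj.ne'
    have hsum : p.eval 0 + q.eval 0 = 0 :=
      (mul_eq_zero.1 (by linear_combination evK - evE :
        (j : ℝ) * (p.eval 0 + q.eval 0) = 0)).resolve_left hjR
    have hp0 : p.eval 0 = 0 :=
      (mul_eq_zero.1 (by linear_combination evK - hsum :
        (j : ℝ) * p.eval 0 = 0)).resolve_left hjR
    have hq0 : q.eval 0 = 0 := by linarith
    have hr0 : r.eval 0 = 0 := by rw [hrs]; simp [hj.ne']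
    have hdvd : ∀ f : ℝ[X], f.eval 0 = 0 → ∃ g, f = X * g := fun f hf => by
      simpa [dvd_def] using dvd_iff_isRoot.2 (hf : f.IsRoot 0)
    obtain ⟨p₁, rfl⟩ := hdvd p hp0
    obtain ⟨q₁, rfl⟩ := hdvd q hq0
    obtain ⟨r₁, rfl⟩ := hdvd r hr0
    have hr₁ := right_ne_zero_of_mul hr
    have hne : ∀ k ∈ Ioo (-1 : ℝ) 1, k ≠ 0 →
        p₁.eval k * Kc k + q₁.eval k * Ec k + r₁.eval k * P k = 0 := fun k hk hk0 => by
      have := h k hk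
      simp only [eval_mul, eval_X] at this
      refine (mul_eq_zero.1 (?_ : k * _ = 0)).resolve_left hk0
      linear_combination this
    refine hr₁ (ih r₁.natDegree ?_ (p := p₁) (q := q₁) (fun k hk => ?_) rfl)
    · rw [← hN, natDegree_X_mul hr₁]
      omega
    · rcases eq_or_ne k 0 with rfl | hk0
      · obtain ⟨_, hdK, _⟩ := hasDerivAt_Kc hk
        obtain ⟨_, hdE, _⟩ := hasDerivAt_Ec hk
        obtain ⟨_, hdP, _⟩ := hP 0 hk
        have hc : ContinuousAt
            (fun k => p₁.eval k * Kc k + q₁.eval k * Ec k + r₁.eval k * P k) 0 :=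
          ((p₁.continuous.continuousAt.mul hdK.continuousAt).add
            (q₁.continuous.continuousAt.mul hdE.continuousAt)).add
            (r₁.continuous.continuousAt.mul hdP.continuousAt)
        refine tendsto_nhds_unique (l := 𝓝[≠] (0 : ℝ))
          (hc.tendsto.mono_left nhdsWithin_le_nhds)
          (tendsto_const_nhds.congr' (f₁ := fun _ => (0 : ℝ)) ?_)
        filter_upwards [self_mem_nhdsWithin, mem_nhdsWithin_of_mem_nhds (isOpen_Ioo.mem_nhds hk)]
          with x hx0 hx using (hne x hx hx0).symm
      · exact hne k hk hk0

theorem Pic_pos {μ k : ℝ} (hμ : μ < 1) (hk : k ∈ Ioo (-1 : ℝ) 1) : 0 < Pic μ k := by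
  rw [Pic_eq_integral]
  have hc := continuous_legendreDelta_right k
  have hpos := fun t => mul_pos (one_sub_mul_sin_sq_pos hμ t) (legendreDelta_pos hk t)
  exact intervalIntegral.intervalIntegral_pos_of_pos
    ((Continuous.div continuous_const (by fun_prop)
      fun t => (hpos t).ne').intervalIntegrable _ _)
    (fun t => one_div_pos.2 (hpos t)) (by positivity)

open Polynomial in
/-- `K`, `E` and `Π(A/B, ·)` are linearly independent over the polynomials. -/
theorem Kc_Ec_Pic_independent {A B : ℝ[X]}
    (hB : ∀ k ∈ Ioo (-1 : ℝ) 1, B.eval k ≠ 0)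
    (hlt : ∀ k ∈ Ioo (-1 : ℝ) 1, A.eval k / B.eval k < 1)
    (h0 : A.eval 0 / B.eval 0 ≠ 0) {p q r : ℝ[X]}
    (h : ∀ k ∈ Ioo (-1 : ℝ) 1, p.eval k * Kc k + q.eval k * Ec k
      + r.eval k * Pic (A.eval k / B.eval k) k = 0) :
    p = 0 ∧ q = 0 ∧ r = 0 := by
  have h0mem : (0 : ℝ) ∈ Ioo (-1 : ℝ) 1 := by norm_num
  have hr : r = 0 := by
    refine independent_of_ode (P := fun k => Pic (A.eval k / B.eval k) k)
      (D := 2 * A * (B - A) * (A - X ^ 2 * B) * (1 - X ^ 2) * B)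
      (H := (1 - X ^ 2) * (derivative A * B - A * derivative B) * (A ^ 2 - X ^ 2 * B ^ 2)
        + 2 * A * (B - A) * B ^ 2 * X * (1 - X ^ 2))
      (CK := (1 - X ^ 2) * (derivative A * B - A * derivative B) * (X ^ 2 * B ^ 2 - A * B))
      (CE := (1 - X ^ 2) * (derivative A * B - A * derivative B) * (A * B)
        - 2 * A * (B - A) * B ^ 2 * X) (fun k hk => ?_) ?_ (Pic_pos (hlt 0 h0mem) h0mem).ne' h
    · obtain ⟨d, hd, e⟩ := Pic_ode (μ := fun k => A.eval k / B.eval k)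
        (μ' := fun k => ((derivative A).eval k * B.eval k - A.eval k * (derivative B).eval k)
          / B.eval k ^ 2) hlt
        (fun x hx => (A.hasDerivAt x).div (B.hasDerivAt x) (hB x hx))
        (ContinuousOn.div (by fun_prop) (by fun_prop) fun x hx => pow_ne_zero _ (hB x hx)) hk
      refine ⟨d, hd, ?_⟩
      have hBk := hB k hk
      simp only [eval_mul, eval_add, eval_sub, eval_X, eval_one, eval_pow, eval_ofNat] at e ⊢
      generalize Pic (A.eval k / B.eval k) k = P at e ⊢
      field_simp at e
      linear_combination e
    · have hB0 := hB 0 h0mem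
      have hA0 : A.eval 0 ≠ 0 := fun hA => h0 (by simp [hA])
      have hBA : B.eval 0 - A.eval 0 ≠ 0 := fun hBA => by
        have := hlt 0 h0mem
        rw [← sub_eq_zero.1 hBA, div_self hB0] at this
        exact lt_irrefl _ this
      simp [hA0, hBA, hB0]
  subst hr
  obtain ⟨hp, hq⟩ := Kc_Ec_independent (p := p) (q := q) fun k hk => by simpa using h k hk
  exact ⟨hp, hq, rfl⟩

open Polynomial in
theorem exists_polynomials_vanishing (f g u : ℝ → ℝ) (m n l : ℕ)
    (pts : Fin (m + n + l + 2) → ℝ) :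
    ∃ p q r : ℝ[X], p.natDegree ≤ m ∧ q.natDegree ≤ n ∧ r.natDegree ≤ l ∧
      ¬(p = 0 ∧ q = 0 ∧ r = 0) ∧
      ∀ i, p.eval (pts i) * f (pts i) + q.eval (pts i) * g (pts i)
        + r.eval (pts i) * u (pts i) = 0 := by
  have hfin : ∀ d, Module.finrank ℝ (degreeLT ℝ d) = d := fun d => by
    rw [(degreeLTEquiv ℝ d).finrank_eq, Module.finrank_fin_fun]
  have hF : ∀ d, Module.Finite ℝ (degreeLT ℝ d) := fun d =>
    Module.Finite.equiv (degreeLTEquiv ℝ d).symm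
  let Φ : (degreeLT ℝ (m + 1) × degreeLT ℝ (n + 1) × degreeLT ℝ (l + 1)) →ₗ[ℝ]
      (Fin (m + n + l + 2) → ℝ) :=
    { toFun := fun v i => v.1.1.eval (pts i) * f (pts i) + v.2.1.1.eval (pts i) * g (pts i)
        + v.2.2.1.eval (pts i) * u (pts i)
      map_add' := fun v w => by
        ext i
        simp only [Prod.fst_add, Prod.snd_add, Submodule.coe_add, eval_add, Pi.add_apply]
        ring
      map_smul' := fun c v => by
        ext i
        simp only [Prod.smul_fst, Prod.smul_snd, Submodule.coe_smul, eval_smul, smul_eq_mul,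
          Pi.smul_apply, RingHom.id_apply]
        ring }
  have hker : LinearMap.ker Φ ≠ ⊥ := Φ.ker_ne_bot_of_finrank_lt (by
    simp only [Module.finrank_prod, hfin, Module.finrank_fin_fun]
    omega)
  obtain ⟨v, hv, hv0⟩ := (Submodule.ne_bot_iff _).1 hker
  have hdeg : ∀ {d : ℕ} (w : degreeLT ℝ (d + 1)), (w : ℝ[X]).natDegree ≤ d := fun {d} w =>
    natDegree_le_of_degree_le (mem_degreeLE.1 (by
      rw [← degreeLT_succ_eq_degreeLE]
      exact w.2))
  refine ⟨v.1.1, v.2.1.1, v.2.2.1, hdeg _, hdeg _, hdeg _, fun ⟨h1, h2, h3⟩ => hv0 ?_, fun i => ?_⟩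
  · exact Prod.ext (Subtype.ext h1) (Prod.ext (Subtype.ext h2) (Subtype.ext h3))
  · exact congrFun (LinearMap.mem_ker.1 hv) i

/-- for a rational parameter `μ = A/B` without poles in `(-1,1)`, with values
in `[0,1)` and `μ'(0) ≠ 0`, and any `m+n+l+2` prescribed distinct points of `(-1,1)`, there
are polynomial coefficients `p, q, r` of degrees at most `m, n, l`, not all zero, such that
`I = pK + qE + rΠ(μ(·),·)` is not identically zero but vanishes at all the prescribed
points; in particular `I` has at least `m+n+l+2` zeros in `(-1,1)`. -/
theorem exists_I_with_prescribed_zeros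
    (A B : Polynomial ℝ)
    (hB : ∀ k ∈ Set.Ioo (-1 : ℝ) 1, B.eval k ≠ 0)
    (hrange : ∀ k ∈ Set.Ioo (-1 : ℝ) 1, A.eval k / B.eval k ∈ Set.Ico (0 : ℝ) 1)
    (hμ' : deriv (fun k : ℝ => A.eval k / B.eval k) 0 ≠ 0)
    (m n l : ℕ) (pts : Fin (m + n + l + 2) → ℝ)
    (hinj : Function.Injective pts)
    (hpts : ∀ i, pts i ∈ Set.Ioo (-1 : ℝ) 1) :
    ∃ p q r : Polynomial ℝ,
      p.natDegree ≤ m ∧ q.natDegree ≤ n ∧ r.natDegree ≤ l ∧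
      ¬(p = 0 ∧ q = 0 ∧ r = 0) ∧
      (¬ ∀ k ∈ Set.Ioo (-1 : ℝ) 1,
        p.eval k * Kc k + q.eval k * Ec k
          + r.eval k * Pic (A.eval k / B.eval k) k = 0) ∧
      ∀ i, p.eval (pts i) * Kc (pts i) + q.eval (pts i) * Ec (pts i)
          + r.eval (pts i) * Pic (A.eval (pts i) / B.eval (pts i)) (pts i) = 0 := by
  have h0mem : (0 : ℝ) ∈ Ioo (-1 : ℝ) 1 := by norm_num
  have hμ0 : A.eval 0 / B.eval 0 ≠ 0 := fun h0 => hμ' (IsLocalMin.deriv_eq_zero (by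
    filter_upwards [isOpen_Ioo.mem_nhds h0mem] with k hk
    simpa only [h0] using (hrange k hk).1))
  obtain ⟨p, q, r, hp, hq, hr, hne, hzero⟩ := exists_polynomials_vanishing Kc Ec
    (fun k => Pic (A.eval k / B.eval k) k) m n l pts
  exact ⟨p, q, r, hp, hq, hr, hne, fun h => hne
    (Kc_Ec_Pic_independent hB (fun k hk => (hrange k hk).2) hμ0 h), hzero⟩
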